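/- Let V, b : ℝ → ℝ be smooth (infinitely differentiable) 1-periodic functions with ∫₀¹ b(y) dy = 0, and define the exact solution u*(x) = ∫₀¹ (∫₀^t b(y) dy) dt − ∫₀^x b(y) dy, m*(x) = e^{V(x) − b(x)²/2} / ∫₀¹ e^{V(y) − b(y)²/2} dy, and H̄* = ln ∫₀¹ e^{V(y) − b(y)²/2} dy. Then there exists a sequence (N_i, γ_i) ∈ ℕ × (0, ∞), i = 1, 2, …, such that for every sequence of triples (u^i, m^i, H̄^i) in which (u^i, m^i, H̄^i) is a minimizer of J_{γ_i} over 𝒢^{N_i} × 𝒢^{N_i} × ℝ, one has, as i → ∞: ∫₀¹ (u^i − u*)² dx → 0 and ∫₀¹ ((u^i)' − (u*)')² dx → 0 (convergence in H¹ of the torus), ∫₀¹ |m^i − m*| dx → 0 (convergence in L¹), and H̄^i → H̄* in ℝ. -/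

import Mathlib

/-- Membership in the one-dimensional Fourier features space `𝒢^N`. -/
def inG (N : ℕ) (φ : ℝ → ℝ) : Prop :=
  ∃ (c : ℝ) (α β : ℕ → ℝ), ∀ x, φ x =
    c + (∑ i ∈ Finset.Icc 1 N, α i * Real.sin (2 * Real.pi * i * x))
      + ∑ i ∈ Finset.Icc 1 N, β i * Real.cos (2 * Real.pi * i * x)

/-- The residual functional `Q(u, m, H̄)`. -/
noncomputable def Qfun (V b u m : ℝ → ℝ) (Hbar : ℝ) : ℝ :=
  (∫ x in (0:ℝ)..1,
      (Real.exp (V x + (deriv u x) ^ 2 / 2 + b x * deriv u x - Hbar) - m x) ^ 2)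
  + (∫ x in (0:ℝ)..1, u x) ^ 2
  + ((∫ x in (0:ℝ)..1, m x) - 1) ^ 2
  + ∫ x in (0:ℝ)..1,
      (m x * (deriv (deriv u) x + deriv b x) + deriv m x * (deriv u x + b x)) ^ 2

/-- The penalized objective `J_γ(u, m, H̄)`. -/
noncomputable def Jfun (V b : ℝ → ℝ) (γ : ℝ) (u m : ℝ → ℝ) (Hbar : ℝ) : ℝ :=
  (∫ x in (0:ℝ)..1, (u x) ^ 2) + (∫ x in (0:ℝ)..1, (m x) ^ 2) + Hbar ^ 2
    + γ * Qfun V b u m Hbar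


theorem inG.mono {N M : ℕ} (h : N ≤ M) {φ : ℝ → ℝ} (hφ : inG N φ) : inG M φ := by
  obtain ⟨c, α, β, hφ⟩ := hφ
  have pad : ∀ (a : ℕ → ℝ) (s : ℕ → ℝ), ∑ i ∈ Finset.Icc 1 M, (if i ≤ N then a i else 0) * s i
      = ∑ i ∈ Finset.Icc 1 N, a i * s i := by
    intro a s
    symm
    refine Finset.sum_subset_zero_on_sdiff (Finset.Icc_subset_Icc le_rfl h) ?_ ?_
    · intro i hi
      simp only [Finset.mem_sdiff, Finset.mem_Icc, not_and, not_le] at hi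
      rw [if_neg (not_le.mpr (hi.2 hi.1.1)), zero_mul]
    · intro i hi
      rw [if_pos (Finset.mem_Icc.mp hi).2]
  exact ⟨c, fun i => if i ≤ N then α i else 0, fun i => if i ≤ N then β i else 0, fun x => by
    rw [pad, pad, hφ]⟩

theorem inG_const (N : ℕ) (a : ℝ) : inG N fun _ => a :=
  ⟨a, 0, 0, fun x => by simp⟩

theorem inG.add {N : ℕ} {φ ψ : ℝ → ℝ} (hφ : inG N φ) (hψ : inG N ψ) :
    inG N fun x => φ x + ψ x := by
  obtain ⟨c, α, β, hφ⟩ := hφ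
  obtain ⟨c', α', β', hψ⟩ := hψ
  refine ⟨c + c', α + α', β + β', fun x => ?_⟩
  simp only [hφ, hψ, Pi.add_apply, add_mul, Finset.sum_add_distrib]
  ring

theorem inG.const_mul {N : ℕ} {φ : ℝ → ℝ} (a : ℝ) (hφ : inG N φ) :
    inG N fun x => a * φ x := by
  obtain ⟨c, α, β, hφ⟩ := hφ
  refine ⟨a * c, fun i => a * α i, fun i => a * β i, fun x => ?_⟩
  simp only [hφ, mul_add, Finset.mul_sum, mul_assoc]

theorem inG_cos (n : ℕ) : inG n fun x => Real.cos (2 * Real.pi * n * x) := by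
  rcases Nat.eq_zero_or_pos n with rfl | hn
  · simpa using inG_const 0 1
  · refine ⟨0, 0, Pi.single n 1, fun x => ?_⟩
    rw [Finset.sum_eq_single_of_mem (s := Finset.Icc 1 n)
      (f := fun i => (Pi.single n 1 : ℕ → ℝ) i * Real.cos (2 * Real.pi * i * x)) n
      (Finset.mem_Icc.mpr ⟨hn, le_rfl⟩)]
    · simp
    · intro i _ hi
      simp [Pi.single_eq_of_ne hi]

theorem inG_sin (n : ℕ) : inG n fun x => Real.sin (2 * Real.pi * n * x) := by
  rcases Nat.eq_zero_or_pos n with rfl | hn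
  · simpa using inG_const 0 0
  · refine ⟨0, Pi.single n 1, 0, fun x => ?_⟩
    rw [Finset.sum_eq_single_of_mem (s := Finset.Icc 1 n)
      (f := fun i => (Pi.single n 1 : ℕ → ℝ) i * Real.sin (2 * Real.pi * i * x)) n
      (Finset.mem_Icc.mpr ⟨hn, le_rfl⟩)]
    · simp
    · intro i _ hi
      simp [Pi.single_eq_of_ne hi]

theorem inG.contDiff {N : ℕ} {φ : ℝ → ℝ} (hφ : inG N φ) : ContDiff ℝ (⊤ : ℕ∞) φ := by
  obtain ⟨c, α, β, hφ⟩ := hφ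
  rw [funext hφ]
  refine (contDiff_const.add (ContDiff.sum fun i _ => ?_)).add (ContDiff.sum fun i _ => ?_) <;>
    fun_prop

theorem inG.one_eq_zero {N : ℕ} {φ : ℝ → ℝ} (hφ : inG N φ) : φ 1 = φ 0 := by
  obtain ⟨c, α, β, hφ⟩ := hφ
  have hs : ∀ i : ℕ, Real.sin (2 * Real.pi * i) = 0 := fun i => by
    rw [show 2 * Real.pi * i = ((2 * i : ℕ) : ℝ) * Real.pi by push_cast; ring]
    exact Real.sin_nat_mul_pi _
  have hc : ∀ i : ℕ, Real.cos (2 * Real.pi * i) = 1 := fun i => by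
    rw [mul_comm]
    exact Real.cos_nat_mul_two_pi i
  simp [hφ, hs, hc]

/-- The derivative of a Fourier-feature function can be prescribed up to its mean. -/
theorem inG.exists_antideriv {N : ℕ} {ψ : ℝ → ℝ} (hψ : inG N ψ) (a : ℝ) :
    ∃ (c : ℝ) (φ : ℝ → ℝ), inG N φ ∧ φ 0 = a ∧ ∀ x, HasDerivAt φ (ψ x - c) x := by
  obtain ⟨c, α, β, hψ⟩ := hψ
  let P : ℝ → ℝ := fun x =>
    (∑ i ∈ Finset.Icc 1 N, (β i / (2 * Real.pi * i)) * Real.sin (2 * Real.pi * i * x))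
      + ∑ i ∈ Finset.Icc 1 N, (-(α i / (2 * Real.pi * i))) * Real.cos (2 * Real.pi * i * x)
  refine ⟨c, fun x => (a - P 0) + P x, ⟨a - P 0, fun i => β i / (2 * Real.pi * i),
    fun i => -(α i / (2 * Real.pi * i)), fun x => ?_⟩, by simp, fun x => ?_⟩
  · simp only [P, add_assoc]
  · refine HasDerivAt.const_add _ ?_
    have hlin : ∀ i : ℕ, HasDerivAt (fun x : ℝ => 2 * Real.pi * i * x) (2 * Real.pi * i) x :=
      fun i => by simpa using (hasDerivAt_id x).const_mul (2 * Real.pi * (i : ℝ))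
    have h1 := HasDerivAt.fun_sum (u := Finset.Icc 1 N) fun i _ =>
      ((hlin i).sin).const_mul (β i / (2 * Real.pi * i))
    have h2 := HasDerivAt.fun_sum (u := Finset.Icc 1 N) fun i _ =>
      ((hlin i).cos).const_mul (-(α i / (2 * Real.pi * i)))
    refine (h1.add h2).congr_deriv ?_
    rw [hψ, show ∀ s t : ℝ, c + s + t - c = t + s by intros; ring]
    have hne : ∀ i ∈ Finset.Icc 1 N, 2 * Real.pi * (i : ℝ) ≠ 0 := fun i hi => by
      have : 0 < i := (Finset.mem_Icc.mp hi).1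
      positivity
    congr 1 <;> refine Finset.sum_congr rfl fun i hi => ?_
    · have := hne i hi
      rw [mul_comm (Real.cos _), ← mul_assoc, div_mul_cancel₀ _ this]
    · have := hne i hi
      rw [mul_comm (-Real.sin _), ← mul_assoc, neg_mul, div_mul_cancel₀ _ this]
      ring

/-- Real and imaginary parts of trigonometric polynomials are Fourier-feature functions. -/
theorem exists_inG_of_mem_span_fourier {g : C(AddCircle (1 : ℝ), ℂ)}
    (hg : g ∈ Submodule.span ℂ (Set.range (@fourier (1 : ℝ)))) :
    ∃ N, inG N (fun x : ℝ => (g (x : AddCircle (1 : ℝ))).re) ∧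
      inG N (fun x : ℝ => (g (x : AddCircle (1 : ℝ))).im) := by
  induction hg using Submodule.span_induction with
  | mem g hg =>
    obtain ⟨n, rfl⟩ := hg
    have hval : ∀ x : ℝ, fourier n (x : AddCircle (1 : ℝ))
        = Complex.exp ((2 * Real.pi * n * x : ℝ) * Complex.I) := fun x => by
      rw [fourier_coe_apply]
      congr 1
      push_cast
      ring
    obtain ⟨k, rfl | rfl⟩ := n.eq_nat_or_neg
    · refine ⟨k, ?_, ?_⟩
      · simp only [hval, Complex.exp_ofReal_mul_I_re]
        simpa using inG_cos k
      · simp only [hval, Complex.exp_ofReal_mul_I_im]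
        simpa using inG_sin k
    · refine ⟨k, ?_, ?_⟩
      · simp only [hval, Complex.exp_ofReal_mul_I_re]
        simpa using inG_cos k
      · simp only [hval, Complex.exp_ofReal_mul_I_im]
        simpa using (inG_sin k).const_mul (-1)
  | zero => exact ⟨0, by simpa using inG_const 0 0, by simpa using inG_const 0 0⟩
  | add f g _ _ hf hg =>
    obtain ⟨N, h1, h2⟩ := hf
    obtain ⟨M, h3, h4⟩ := hg
    refine ⟨max N M, ?_, ?_⟩
    · simpa using (h1.mono (le_max_left N M)).add (h3.mono (le_max_right N M))
    · simpa using (h2.mono (le_max_left N M)).add (h4.mono (le_max_right N M))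
  | smul a f _ hf =>
    obtain ⟨N, h1, h2⟩ := hf
    refine ⟨N, ?_, ?_⟩
    · simpa [sub_eq_add_neg] using (h1.const_mul a.re).add (h2.const_mul (-a.im))
    · simpa [add_comm] using (h2.const_mul a.re).add (h1.const_mul a.im)

/-- Uniform density of the Fourier-feature functions in the continuous periodic functions. -/
theorem exists_inG_abs_sub_le {f : ℝ → ℝ} (hf : Continuous f) (hp : Function.Periodic f 1)
    {ε : ℝ} (hε : 0 < ε) : ∃ N φ, inG N φ ∧ ∀ x, |φ x - f x| ≤ ε := by
  have : Fact ((0 : ℝ) < 1) := ⟨one_pos⟩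
  let F : C(AddCircle (1 : ℝ), ℂ) :=
    ⟨fun x => ((hp.lift x : ℝ) : ℂ), Complex.continuous_ofReal.comp (hf.quotient_lift _)⟩
  have hF : F ∈ (Submodule.span ℂ (Set.range (@fourier (1 : ℝ)))).topologicalClosure := by
    rw [span_fourier_closure_eq_top]; trivial
  obtain ⟨g, hg, hgF⟩ := Metric.mem_closure_iff.mp hF ε hε
  obtain ⟨N, hN, -⟩ := exists_inG_of_mem_span_fourier hg
  refine ⟨N, _, hN, fun x => ?_⟩
  have h1 : f x = (F (x : AddCircle (1 : ℝ))).re := by simp [F]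
  rw [h1, ← Complex.sub_re]
  calc _ ≤ ‖g (x : AddCircle (1 : ℝ)) - F x‖ := Complex.abs_re_le_norm _
    _ = ‖(g - F) x‖ := rfl
    _ ≤ ‖g - F‖ := ContinuousMap.norm_coe_le_norm _ _
    _ ≤ ε := by rw [← dist_eq_norm, dist_comm]; exact hgF.le

/-- Primitives of good approximations of `f'` give good approximations of `f` in `C¹`. -/
theorem inG.exists_primitive_approx {N : ℕ} {f f' ψ : ℝ → ℝ} {ε : ℝ} (hψ : inG N ψ)
    (hf : ∀ x, HasDerivAt f (f' x) x) (hf1 : f 1 = f 0)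
    (hε : ∀ x ∈ Set.Icc (0 : ℝ) 1, |ψ x - f' x| ≤ ε) :
    ∃ (c : ℝ) (φ : ℝ → ℝ), inG N φ ∧ (∀ x, HasDerivAt φ (ψ x - c) x) ∧ |c| ≤ ε ∧
      ∀ x ∈ Set.Icc (0 : ℝ) 1, |φ x - f x| ≤ 2 * ε := by
  obtain ⟨c, φ, hφ, hφ0, hφ'⟩ := hψ.exists_antideriv (f 0)
  have hd : ∀ x, HasDerivAt (fun y => φ y - f y + c * y) (ψ x - f' x) x := fun x =>
    ((((hφ' x).sub (hf x)).add ((hasDerivAt_id x).const_mul c))).congr_deriv (by ring)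
  have hb : ∀ x ∈ Set.Icc (0 : ℝ) 1, |φ x - f x + c * x| ≤ ε * x := fun x hx => by
    have := norm_image_sub_le_of_norm_deriv_le_segment' (a := 0) (b := 1) (C := ε)
      (fun x _ => (hd x).hasDerivWithinAt) (fun x hx => hε x ⟨hx.1, hx.2.le⟩) x hx
    simpa [hφ0] using this
  have hc : |c| ≤ ε := by simpa [hφ.one_eq_zero, hφ0, hf1] using hb 1 (by simp)
  refine ⟨c, φ, hφ, hφ', hc, fun x hx => ?_⟩
  have h1 := hb x hx
  have h2 : |c * x| ≤ ε := by
    rw [abs_mul, abs_of_nonneg hx.1]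
    nlinarith [abs_nonneg c, hx.1, hx.2]
  have h3 : ε * x ≤ ε := by nlinarith [abs_nonneg c, hx.2]
  rw [abs_le] at *
  constructor <;> linarith

theorem exists_inG_approx_one {f f' : ℝ → ℝ} (hf : ∀ x, HasDerivAt f (f' x) x)
    (hf1 : f 1 = f 0) (hc : Continuous f') (hp : Function.Periodic f' 1) {ε : ℝ} (hε : 0 < ε) :
    ∃ N φ, inG N φ ∧ ∀ x ∈ Set.Icc (0 : ℝ) 1, |φ x - f x| ≤ ε ∧ |deriv φ x - f' x| ≤ ε := by
  obtain ⟨N, ψ, hψ, h⟩ := exists_inG_abs_sub_le hc hp (half_pos hε)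
  obtain ⟨c, φ, hφ, hφ', hc, hb⟩ := hψ.exists_primitive_approx hf hf1 fun x _ => h x
  refine ⟨N, φ, hφ, fun x hx => ⟨by linarith [hb x hx], ?_⟩⟩
  rw [(hφ' x).deriv]
  have := h x
  rw [abs_le] at *
  constructor <;> linarith

theorem exists_inG_approx_two {f f' f'' : ℝ → ℝ} (hf : ∀ x, HasDerivAt f (f' x) x)
    (hf' : ∀ x, HasDerivAt f' (f'' x) x) (hf1 : f 1 = f 0) (hf1' : f' 1 = f' 0)
    (hc : Continuous f'') (hp : Function.Periodic f'' 1) {ε : ℝ} (hε : 0 < ε) :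
    ∃ N φ, inG N φ ∧ ∀ x ∈ Set.Icc (0 : ℝ) 1, |φ x - f x| ≤ ε ∧ |deriv φ x - f' x| ≤ ε ∧
      |deriv (deriv φ) x - f'' x| ≤ ε := by
  obtain ⟨N, ψ, hψ, h⟩ := exists_inG_approx_one hf' hf1' hc hp (half_pos hε)
  obtain ⟨c, φ, hφ, hφ', hc, hb⟩ := hψ.exists_primitive_approx hf hf1 fun x hx => (h x hx).1
  have hdφ : deriv φ = fun x => ψ x - c := funext fun x => (hφ' x).deriv
  refine ⟨N, φ, hφ, fun x hx => ⟨by linarith [hb x hx], ?_, ?_⟩⟩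
  · rw [hdφ]
    have := (h x hx).1
    rw [abs_le] at *
    constructor <;> linarith
  · rw [hdφ, deriv_sub_const]
    linarith [(h x hx).2]

/-- Passage to the limit in integrals of continuous expressions of uniformly convergent functions. -/
theorem tendsto_integral_comp {E : Type*} [NormedAddCommGroup E] [ProperSpace E]
    {F : ℝ × E → ℝ} (hF : Continuous F) {p : ℕ → ℝ → E} {q : ℝ → E}
    (hp : ∀ n, Continuous (p n)) (hq : Continuous q)
    (hpq : ∀ n : ℕ, ∀ x ∈ Set.Icc (0 : ℝ) 1, ‖p n x - q x‖ ≤ 1 / ((n : ℝ) + 1)) :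
    Filter.Tendsto (fun n => ∫ x in (0 : ℝ)..1, F (x, p n x)) Filter.atTop
      (nhds (∫ x in (0 : ℝ)..1, F (x, q x))) := by
  obtain ⟨R, hR⟩ := (isCompact_Icc (a := (0 : ℝ)) (b := 1)).exists_bound_of_continuousOn
    hq.continuousOn
  obtain ⟨C, hC⟩ := ((isCompact_Icc (a := (0 : ℝ)) (b := 1)).prod
    (isCompact_closedBall (0 : E) (R + 1))).exists_bound_of_continuousOn hF.continuousOn
  have hsub : Set.uIoc (0 : ℝ) 1 ⊆ Set.Icc 0 1 := by
    rw [Set.uIoc_of_le zero_le_one]; exact Set.Ioc_subset_Icc_self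
  refine intervalIntegral.tendsto_integral_filter_of_dominated_convergence (fun _ => C)
    (.of_forall fun n => ?_) (.of_forall fun n => .of_forall fun x hx => ?_)
    intervalIntegrable_const (.of_forall fun x hx => ?_)
  · have := hp n
    exact Continuous.aestronglyMeasurable (by fun_prop)
  · refine hC _ ⟨hsub hx, ?_⟩
    have h1 : 1 / ((n : ℝ) + 1) ≤ 1 := by
      rw [div_le_one (by positivity)]
      linarith [n.cast_nonneg (α := ℝ)]
    have h2 := norm_le_norm_add_norm_sub (q x) (p n x)
    rw [norm_sub_rev] at h2
    rw [mem_closedBall_zero_iff]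
    linarith [hpq n x (hsub hx), hR x (hsub hx)]
  · refine (hF.tendsto _).comp (tendsto_const_nhds.prodMk_nhds ?_)
    rw [tendsto_iff_norm_sub_tendsto_zero]
    exact squeeze_zero (fun _ => norm_nonneg _) (fun n => hpq n x (hsub hx))
      tendsto_one_div_add_atTop_nhds_zero_nat

theorem periodic_deriv {f : ℝ → ℝ} {c : ℝ} (hf : Function.Periodic f c) :
    Function.Periodic (deriv f) c := fun x => by
  rw [← deriv_comp_add_const, funext hf]

/-- Smooth periodic pairs are approximated by Fourier-feature functions, with convergence of the
residual functional. -/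
theorem exists_inG_Qfun_lt {V b u m : ℝ → ℝ} (H : ℝ) (hV : Continuous V)
    (hb : ContDiff ℝ (⊤ : ℕ∞) b) (hu : ContDiff ℝ (⊤ : ℕ∞) u) (hm : ContDiff ℝ (⊤ : ℕ∞) m)
    (hup : Function.Periodic u 1) (hmp : Function.Periodic m 1) {δ : ℝ} (hδ : 0 < δ) :
    ∃ N φ ψ, inG N φ ∧ inG N ψ ∧
      (∫ x in (0 : ℝ)..1, φ x ^ 2) < (∫ x in (0 : ℝ)..1, u x ^ 2) + 1 ∧
      (∫ x in (0 : ℝ)..1, ψ x ^ 2) < (∫ x in (0 : ℝ)..1, m x ^ 2) + 1 ∧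
      Qfun V b φ ψ H < Qfun V b u m H + δ := by
  have hdiff : ∀ {f : ℝ → ℝ}, ContDiff ℝ (⊤ : ℕ∞) f → ContDiff ℝ (⊤ : ℕ∞) (deriv f) :=
    fun hf => (contDiff_infty_iff_deriv.mp hf).2
  have hderiv : ∀ {f : ℝ → ℝ}, ContDiff ℝ (⊤ : ℕ∞) f → ∀ x, HasDerivAt f (deriv f x) x :=
    fun hf x => ((contDiff_infty_iff_deriv.mp hf).1 x).hasDerivAt
  have hper : ∀ {f : ℝ → ℝ}, Function.Periodic f 1 → f 1 = f 0 := fun hf => by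
    simpa using hf 0
  have key : ∀ n : ℕ, ∃ N φ ψ, inG N φ ∧ inG N ψ ∧ ∀ x ∈ Set.Icc (0 : ℝ) 1,
      ‖(φ x, deriv φ x, deriv (deriv φ) x, ψ x, deriv ψ x)
        - (u x, deriv u x, deriv (deriv u) x, m x, deriv m x)‖ ≤ 1 / ((n : ℝ) + 1) := by
    intro n
    have hn : 0 < 1 / ((n : ℝ) + 1) := by positivity
    obtain ⟨N, φ, hφ, h1⟩ := exists_inG_approx_two (hderiv hu) (hderiv (hdiff hu)) (hper hup)
      (hper (periodic_deriv hup)) (hdiff (hdiff hu)).continuous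
      (periodic_deriv (periodic_deriv hup)) hn
    obtain ⟨M, ψ, hψ, h2⟩ := exists_inG_approx_one (hderiv hm) (hper hmp)
      (hdiff hm).continuous (periodic_deriv hmp) hn
    refine ⟨max N M, φ, ψ, hφ.mono (le_max_left _ _), hψ.mono (le_max_right _ _), fun x hx => ?_⟩
    obtain ⟨h3, h4, h5⟩ := h1 x hx
    obtain ⟨h6, h7⟩ := h2 x hx
    simp only [Prod.norm_def, Prod.mk_sub_mk, Real.norm_eq_abs, sup_le_iff]
    exact ⟨h3, h4, h5, h6, h7⟩
  choose N φ ψ hφ hψ hclose using key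
  have lim : ∀ F : ℝ × ℝ × ℝ × ℝ × ℝ × ℝ → ℝ, Continuous F → Filter.Tendsto
      (fun n => ∫ x in (0 : ℝ)..1,
        F (x, φ n x, deriv (φ n) x, deriv (deriv (φ n)) x, ψ n x, deriv (ψ n) x))
      Filter.atTop (nhds (∫ x in (0 : ℝ)..1,
        F (x, u x, deriv u x, deriv (deriv u) x, m x, deriv m x))) := by
    intro F hF
    refine tendsto_integral_comp hF (fun n => ?_) ?_ hclose
    · exact (hφ n).contDiff.continuous.prodMk ((hdiff (hφ n).contDiff).continuous.prodMk
        ((hdiff (hdiff (hφ n).contDiff)).continuous.prodMk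
        ((hψ n).contDiff.continuous.prodMk (hdiff (hψ n).contDiff).continuous)))
    · exact hu.continuous.prodMk ((hdiff hu).continuous.prodMk
        ((hdiff (hdiff hu)).continuous.prodMk (hm.continuous.prodMk (hdiff hm).continuous)))
  have hbc := hb.continuous
  have hb'c := (hdiff hb).continuous
  have lu := lim (fun z => z.2.1 ^ 2) (by fun_prop)
  have lm := lim (fun z => z.2.2.2.2.1 ^ 2) (by fun_prop)
  have l1 := lim (fun z => (Real.exp (V z.1 + z.2.2.1 ^ 2 / 2 + b z.1 * z.2.2.1 - H)
    - z.2.2.2.2.1) ^ 2) (by fun_prop)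
  have l2 := lim (fun z => z.2.1) (by fun_prop)
  have l3 := lim (fun z => z.2.2.2.2.1) (by fun_prop)
  have l4 := lim (fun z => (z.2.2.2.2.1 * (z.2.2.2.1 + deriv b z.1)
    + z.2.2.2.2.2 * (z.2.2.1 + b z.1)) ^ 2) (by fun_prop)
  have lQ : Filter.Tendsto (fun n => Qfun V b (φ n) (ψ n) H) Filter.atTop
      (nhds (Qfun V b u m H)) :=
    ((l1.add (l2.pow 2)).add ((l3.sub_const 1).pow 2)).add l4
  obtain ⟨n, h1, h2, h3⟩ := ((lu.eventually_lt_const (lt_add_one _)).and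
    ((lm.eventually_lt_const (lt_add_one _)).and
      (lQ.eventually_lt_const (lt_add_of_pos_right _ hδ)))).exists
  exact ⟨N n, φ n, ψ n, hφ n, hψ n, h1, h2, h3⟩

theorem integral_le_of_continuous {f g : ℝ → ℝ} (hf : Continuous f) (hg : Continuous g)
    (h : ∀ x ∈ Set.Icc (0 : ℝ) 1, f x ≤ g x) :
    (∫ x in (0 : ℝ)..1, f x) ≤ ∫ x in (0 : ℝ)..1, g x :=
  intervalIntegral.integral_mono_on zero_le_one (hf.intervalIntegrable _ _)
    (hg.intervalIntegrable _ _) h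

theorem sq_integral_abs_le {f : ℝ → ℝ} (hf : Continuous f) :
    (∫ x in (0 : ℝ)..1, |f x|) ^ 2 ≤ ∫ x in (0 : ℝ)..1, f x ^ 2 := by
  set D := ∫ x in (0 : ℝ)..1, |f x| with hD
  have h := integral_le_of_continuous (f := fun x => 2 * D * |f x| - D ^ 2)
    (g := fun x => f x ^ 2) (by fun_prop) (by fun_prop) fun x _ => by
      nlinarith [sq_nonneg (|f x| - D), sq_abs (f x)]
  rw [intervalIntegral.integral_sub (Continuous.intervalIntegrable (by fun_prop) _ _)
    (by simp), intervalIntegral.integral_const_mul, ← hD] at h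
  simp only [intervalIntegral.integral_const, smul_eq_mul] at h
  linarith

theorem integral_abs_le_of_integral_sq_le {f : ℝ → ℝ} (hf : Continuous f) {ε : ℝ} (hε : 0 ≤ ε)
    (h : (∫ x in (0 : ℝ)..1, f x ^ 2) ≤ ε ^ 2) : (∫ x in (0 : ℝ)..1, |f x|) ≤ ε :=
  abs_le_of_sq_le_sq ((sq_integral_abs_le hf).trans h) hε |>.trans' (le_abs_self _)

theorem abs_sub_le_integral_abs_deriv {f r : ℝ → ℝ} (hr : Continuous r)
    (hd : ∀ x, HasDerivAt f (r x) x) {x y : ℝ} (hx : x ∈ Set.Icc (0 : ℝ) 1)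
    (hy : y ∈ Set.Icc (0 : ℝ) 1) : |f x - f y| ≤ ∫ t in (0 : ℝ)..1, |r t| := by
  rw [← intervalIntegral.integral_eq_sub_of_hasDerivAt (fun t _ => hd t)
    (hr.intervalIntegrable y x)]
  have h1 := intervalIntegral.norm_integral_le_abs_integral_norm (f := r) (a := y) (b := x)
    (μ := MeasureTheory.volume)
  refine h1.trans ((intervalIntegral.abs_integral_mono_interval (c := 0) (d := 1) ?_ ?_ ?_).trans
    ?_)
  · rw [Set.uIoc_of_le zero_le_one]
    exact Set.Ioc_subset_Ioc (le_min hy.1 hx.1) (max_le hy.2 hx.2)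
  · exact Filter.Eventually.of_forall fun _ => norm_nonneg _
  · exact hr.norm.intervalIntegrable _ _
  · exact (abs_of_nonneg (intervalIntegral.integral_nonneg zero_le_one
      fun _ _ => norm_nonneg _)).le

/-- A Poincaré inequality on the unit interval. -/
theorem integral_sq_le_of_hasDerivAt {f r : ℝ → ℝ} (hr : Continuous r)
    (hd : ∀ x, HasDerivAt f (r x) x) :
    (∫ x in (0 : ℝ)..1, f x ^ 2)
      ≤ 2 * (∫ x in (0 : ℝ)..1, r x ^ 2) + 2 * (∫ x in (0 : ℝ)..1, f x) ^ 2 := by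
  have hf : Continuous f := continuous_iff_continuousAt.mpr fun x => (hd x).continuousAt
  set D := ∫ x in (0 : ℝ)..1, |r x|
  set μ := ∫ x in (0 : ℝ)..1, f x
  have hD : D ^ 2 ≤ ∫ x in (0 : ℝ)..1, r x ^ 2 := sq_integral_abs_le hr
  have hpt : ∀ x ∈ Set.Icc (0 : ℝ) 1, f x ^ 2 ≤ 2 * D ^ 2 + 2 * μ ^ 2 := by
    intro x hx
    have h1 : f x - D ≤ μ := by
      simpa using integral_le_of_continuous (f := fun _ => f x - D) continuous_const hf fun y hy => by
        linarith [(abs_le.mp (abs_sub_le_integral_abs_deriv hr hd hx hy)).2]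
    have h2 : μ ≤ f x + D := by
      simpa using integral_le_of_continuous (g := fun _ => f x + D) hf continuous_const fun y hy => by
        linarith [(abs_le.mp (abs_sub_le_integral_abs_deriv hr hd hx hy)).1]
    have h3 : (f x - μ) ^ 2 ≤ D ^ 2 := sq_le_sq' (by linarith) (by linarith)
    nlinarith [sq_nonneg (f x - 2 * μ)]
  have := integral_le_of_continuous (hf.pow 2) continuous_const hpt
  simp only [intervalIntegral.integral_const, smul_eq_mul, Pi.pow_apply] at this
  linarith

/-- The energy estimate: if `g` is close to `m`, `(m w)'` is small and `w` has mean zero, then `w`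
is small with respect to the weight `g`. -/
theorem integral_mul_sq_le {w m g r : ℝ → ℝ} {ε : ℝ} (hε : 0 < ε) (hw : Continuous w)
    (hm : Continuous m) (hg : Continuous g) (hr : Continuous r)
    (hd : ∀ x, HasDerivAt (fun y => m y * w y) (r x) x) (hw0 : (∫ x in (0 : ℝ)..1, w x) = 0)
    (hgm : (∫ x in (0 : ℝ)..1, (g x - m x) ^ 2) ≤ ε ^ 2)
    (hrε : (∫ x in (0 : ℝ)..1, r x ^ 2) ≤ ε ^ 2) :
    (∫ x in (0 : ℝ)..1, g x * w x ^ 2) ≤ 2 * (1 + ∫ x in (0 : ℝ)..1, w x ^ 4) * ε := by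
  have hr1 := integral_abs_le_of_integral_sq_le hr hε.le hrε
  set c := m 0 * w 0 with hc
  have hpt : ∀ x ∈ Set.Icc (0 : ℝ) 1, g x * w x ^ 2
      ≤ c * w x + (1 / (2 * ε) * (g x - m x) ^ 2 + (3 / 2 * ε * w x ^ 4 + ε)) := by
    intro x hx
    have h1 : |m x * w x - c| ≤ ε :=
      (abs_sub_le_integral_abs_deriv hr hd hx (by simp)).trans hr1
    have h2 : (m x * w x - c) * w x ≤ ε * (1 + w x ^ 4) := by
      refine (le_abs_self _).trans ?_
      rw [abs_mul]
      refine mul_le_mul h1 ?_ (abs_nonneg _) hε.le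
      have : w x ^ 4 = |w x| ^ 4 := (Even.pow_abs (by decide) _).symm
      rw [this]
      nlinarith [sq_nonneg (|w x| - 1), sq_nonneg (|w x| ^ 2 - 1), sq_nonneg (|w x|)]
    have h3 : (g x - m x) * w x ^ 2 ≤ 1 / (2 * ε) * (g x - m x) ^ 2 + ε / 2 * w x ^ 4 := by
      have : 1 / (2 * ε) * (g x - m x) ^ 2 + ε / 2 * w x ^ 4 - (g x - m x) * w x ^ 2
          = 1 / (2 * ε) * ((g x - m x) - ε * w x ^ 2) ^ 2 := by
        field_simp
        ring
      have h4 : 0 ≤ 1 / (2 * ε) * ((g x - m x) - ε * w x ^ 2) ^ 2 := by positivity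
      linarith
    linarith
  have h := integral_le_of_continuous (by fun_prop) (by fun_prop) hpt
  rw [intervalIntegral.integral_add (Continuous.intervalIntegrable (by fun_prop) _ _)
      (Continuous.intervalIntegrable (by fun_prop) _ _),
    intervalIntegral.integral_add (Continuous.intervalIntegrable (by fun_prop) _ _)
      (Continuous.intervalIntegrable (by fun_prop) _ _),
    intervalIntegral.integral_add (Continuous.intervalIntegrable (by fun_prop) _ _)
      (by simp),
    intervalIntegral.integral_const_mul, intervalIntegral.integral_const_mul,
    intervalIntegral.integral_const_mul, hw0] at h
  simp only [intervalIntegral.integral_const, smul_eq_mul] at h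
  have h5 : 1 / (2 * ε) * (∫ x in (0 : ℝ)..1, (g x - m x) ^ 2) ≤ ε / 2 := by
    calc _ ≤ 1 / (2 * ε) * ε ^ 2 := by gcongr
      _ = ε / 2 := by field_simp
  have h6 : 0 ≤ ε * ∫ x in (0 : ℝ)..1, w x ^ 4 :=
    mul_nonneg hε.le (intervalIntegral.integral_nonneg zero_le_one fun _ _ => by positivity)
  nlinarith

set_option maxHeartbeats 1000000 in
/-- Near-zeros of the residual functional are close to the explicit solution. -/
theorem exists_stability_constant {V b : ℝ → ℝ} (hV : Continuous V)
    (hb : ContDiff ℝ (⊤ : ℕ∞) b) (hbint : (∫ y in (0 : ℝ)..1, b y) = 0) (K : ℝ) :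
    ∃ C, ∀ (ε : ℝ) (u m : ℝ → ℝ) (H : ℝ), 0 < ε → ε ≤ 1 → ContDiff ℝ (⊤ : ℕ∞) u →
      ContDiff ℝ (⊤ : ℕ∞) m → u 1 = u 0 → (∫ x in (0 : ℝ)..1, m x ^ 2) ≤ K → H ^ 2 ≤ K →
      Qfun V b u m H ≤ ε ^ 2 →
      (∫ x in (0 : ℝ)..1, u x) ^ 2 ≤ ε ^ 2 ∧
      (∫ x in (0 : ℝ)..1, (deriv u x + b x) ^ 2) ≤ C * ε ∧
      (∫ x in (0 : ℝ)..1, |m x - Real.exp (V x - b x ^ 2 / 2)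
        / ∫ y in (0 : ℝ)..1, Real.exp (V y - b y ^ 2 / 2)|) ≤ C * ε ∧
      |Real.exp (-H) * (∫ y in (0 : ℝ)..1, Real.exp (V y - b y ^ 2 / 2)) - 1| ≤ C * ε := by
  have hbc := hb.continuous
  have hb'c := (contDiff_infty_iff_deriv.mp hb).2.continuous
  set G : ℝ → ℝ := fun x => Real.exp (V x - b x ^ 2 / 2) with hG
  have hGc : Continuous G := by fun_prop
  have hGpos : ∀ x, 0 < G x := fun x => Real.exp_pos _
  obtain ⟨x₀, -, hx₀⟩ := (isCompact_Icc (a := (0 : ℝ)) (b := 1)).exists_isMinOn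
    ⟨0, by simp⟩ hGc.continuousOn
  set Z := ∫ y in (0 : ℝ)..1, G y with hZ
  have hZpos : 0 < Z := intervalIntegral.intervalIntegral_pos_of_pos
    (hGc.intervalIntegrable _ _) hGpos zero_lt_one
  set k := G x₀ * Real.exp (-(K + 1)) with hk
  have hkpos : 0 < k := mul_pos (hGpos _) (Real.exp_pos _)
  set B := 1 + 4 / k ^ 2 * (2 * K + 2) with hB
  refine ⟨2 * B / k + 2 * B + 3, ?_⟩
  intro ε u m H hε hε1 hu hm hu1 hmK hHK hQ
  have hu'c := (contDiff_infty_iff_deriv.mp hu).2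
  have hu''c := (contDiff_infty_iff_deriv.mp hu'c).2.continuous
  have hmc := hm.continuous
  have hm'c := (contDiff_infty_iff_deriv.mp hm).2.continuous
  have hu'cc := hu'c.continuous
  set w : ℝ → ℝ := fun x => deriv u x + b x with hw
  have hwc : Continuous w := by fun_prop
  set g : ℝ → ℝ := fun x => G x * Real.exp (-H) * Real.exp (w x ^ 2 / 2) with hg
  have hgc : Continuous g := by fun_prop
  have hgeq : ∀ x, Real.exp (V x + (deriv u x) ^ 2 / 2 + b x * deriv u x - H) = g x := fun x => by
    simp only [hg, hG, hw, ← Real.exp_add]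
    congr 1
    ring
  set r : ℝ → ℝ := fun x =>
    m x * (deriv (deriv u) x + deriv b x) + deriv m x * (deriv u x + b x) with hr
  have hrc : Continuous r := by fun_prop
  have hQ' : (∫ x in (0 : ℝ)..1, (g x - m x) ^ 2) + (∫ x in (0 : ℝ)..1, u x) ^ 2
      + ((∫ x in (0 : ℝ)..1, m x) - 1) ^ 2 + (∫ x in (0 : ℝ)..1, r x ^ 2) ≤ ε ^ 2 := by
    simpa only [Qfun, hgeq] using hQ
  have hq1 : 0 ≤ ∫ x in (0 : ℝ)..1, (g x - m x) ^ 2 :=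
    intervalIntegral.integral_nonneg zero_le_one fun _ _ => sq_nonneg _
  have hq4 : 0 ≤ ∫ x in (0 : ℝ)..1, r x ^ 2 :=
    intervalIntegral.integral_nonneg zero_le_one fun _ _ => sq_nonneg _
  have hq2 := sq_nonneg (∫ x in (0 : ℝ)..1, u x)
  have hq3 := sq_nonneg ((∫ x in (0 : ℝ)..1, m x) - 1)
  have hgm : (∫ x in (0 : ℝ)..1, (g x - m x) ^ 2) ≤ ε ^ 2 := by linarith
  have hw0 : (∫ x in (0 : ℝ)..1, w x) = 0 := by
    rw [hw, intervalIntegral.integral_add (hu'cc.intervalIntegrable _ _)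
      (hbc.intervalIntegrable _ _), hbint, intervalIntegral.integral_deriv_eq_sub
      (fun x _ => (contDiff_infty_iff_deriv.mp hu).1 x) (hu'cc.intervalIntegrable _ _), hu1]
    ring
  have hd : ∀ x, HasDerivAt (fun y => m y * w y) (r x) x := fun x => by
    have h1 := ((contDiff_infty_iff_deriv.mp hm).1 x).hasDerivAt
    have h2 := (((contDiff_infty_iff_deriv.mp hu'c).1 x).hasDerivAt).add
      ((contDiff_infty_iff_deriv.mp hb).1 x).hasDerivAt
    exact (h1.mul h2).congr_deriv (by simp only [hr, Pi.add_apply]; ring)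
  have hkG : ∀ x ∈ Set.Icc (0 : ℝ) 1, k ≤ G x * Real.exp (-H) := fun x hx => by
    refine mul_le_mul (hx₀ hx) (Real.exp_le_exp.mpr ?_) (Real.exp_pos _).le (hGpos x).le
    nlinarith [sq_nonneg (H - 1)]
  have hW : (∫ x in (0 : ℝ)..1, w x ^ 4) ≤ 4 / k ^ 2 * (2 * K + 2) := by
    have h := integral_le_of_continuous (f := fun x => w x ^ 4)
      (g := fun x => 4 / k ^ 2 * (2 * m x ^ 2 + 2 * (g x - m x) ^ 2))
      (by fun_prop) (by fun_prop) fun x hx => by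
        have h1 : k * (w x ^ 2 / 2) ≤ g x :=
          mul_le_mul (hkG x hx) (by linarith [Real.add_one_le_exp (w x ^ 2 / 2)])
            (by positivity) (by have := hGpos x; positivity)
        have h2 : (k * (w x ^ 2 / 2)) ^ 2 ≤ g x ^ 2 := by gcongr
        have h3 : w x ^ 4 = 4 / k ^ 2 * (k * (w x ^ 2 / 2)) ^ 2 := by field_simp; ring
        rw [h3]
        gcongr
        nlinarith [sq_nonneg (g x - 2 * m x)]
    rw [intervalIntegral.integral_const_mul, intervalIntegral.integral_add
      (Continuous.intervalIntegrable (by fun_prop) _ _)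
      (Continuous.intervalIntegrable (by fun_prop) _ _), intervalIntegral.integral_const_mul,
      intervalIntegral.integral_const_mul] at h
    refine h.trans ?_
    gcongr
    nlinarith
  have hgw : (∫ x in (0 : ℝ)..1, g x * w x ^ 2) ≤ 2 * B * ε :=
    (integral_mul_sq_le hε hwc hmc hgc hrc hd hw0 hgm (by linarith)).trans
      (by gcongr; linarith)
  have hBnn : 0 ≤ 2 * B * ε := (intervalIntegral.integral_nonneg zero_le_one fun x _ => by
    have := hGpos x; positivity).trans hgw
  have hw2 : (∫ x in (0 : ℝ)..1, w x ^ 2) ≤ 2 * B / k * ε := by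
    have h := integral_le_of_continuous (f := fun x => k * w x ^ 2)
      (g := fun x => g x * w x ^ 2) (by fun_prop) (by fun_prop) fun x hx => by
        gcongr
        exact (hkG x hx).trans (le_mul_of_one_le_right (by have := hGpos x; positivity)
          (Real.one_le_exp (by positivity)))
    rw [intervalIntegral.integral_const_mul] at h
    rw [div_mul_eq_mul_div, le_div_iff₀ hkpos]
    linarith
  have hgm1 : (∫ x in (0 : ℝ)..1, |g x - m x|) ≤ ε :=
    integral_abs_le_of_integral_sq_le (by fun_prop) hε.le hgm
  have hmG : (∫ x in (0 : ℝ)..1, |m x - G x * Real.exp (-H)|) ≤ (1 + B) * ε := by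
    have h := integral_le_of_continuous (f := fun x => |m x - G x * Real.exp (-H)|)
      (g := fun x => |g x - m x| + 1 / 2 * (g x * w x ^ 2)) (by fun_prop) (by fun_prop)
      fun x _ => by
        have h1 : 0 < G x * Real.exp (-H) := mul_pos (hGpos x) (Real.exp_pos _)
        have h2 : g x - G x * Real.exp (-H) ≤ 1 / 2 * (g x * w x ^ 2) := by
          have h3 := Real.add_one_le_exp (-(w x ^ 2 / 2))
          have h4 : Real.exp (w x ^ 2 / 2) * Real.exp (-(w x ^ 2 / 2)) = 1 := by
            rw [← Real.exp_add]; simp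
          have h5 : g x * Real.exp (-(w x ^ 2 / 2)) = G x * Real.exp (-H) := by
            simp only [hg]; rw [mul_assoc, h4, mul_one]
          have h6 : 0 < g x := mul_pos h1 (Real.exp_pos _)
          nlinarith
        have h7 : 0 ≤ g x - G x * Real.exp (-H) :=
          sub_nonneg.mpr (le_mul_of_one_le_right h1.le (Real.one_le_exp (by positivity)))
        rw [abs_le]
        have h8 := neg_abs_le (g x - m x)
        have h9 := le_abs_self (g x - m x)
        constructor <;> linarith
    rw [intervalIntegral.integral_add (Continuous.intervalIntegrable (by fun_prop) _ _)
      (Continuous.intervalIntegrable (by fun_prop) _ _), intervalIntegral.integral_const_mul] at h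
    linarith
  have hm1 : |(∫ x in (0 : ℝ)..1, m x) - 1| ≤ ε := abs_le_of_sq_le_sq (by linarith) hε.le
  have hHZ : |Real.exp (-H) * Z - 1| ≤ (2 + B) * ε := by
    have h1 : (∫ x in (0 : ℝ)..1, (m x - G x * Real.exp (-H)))
        = (∫ x in (0 : ℝ)..1, m x) - Real.exp (-H) * Z := by
      rw [intervalIntegral.integral_sub (hmc.intervalIntegrable _ _)
        (Continuous.intervalIntegrable (by fun_prop) _ _), intervalIntegral.integral_mul_const,
        mul_comm]
    have h2 := (intervalIntegral.abs_integral_le_integral_abs (μ := MeasureTheory.volume)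
      (f := fun x => m x - G x * Real.exp (-H)) zero_le_one).trans hmG
    rw [h1] at h2
    rw [abs_le] at *
    constructor <;> linarith
  have hmZ : (∫ x in (0 : ℝ)..1, |m x - G x / Z|) ≤ (3 + 2 * B) * ε := by
    have h := integral_le_of_continuous (f := fun x => |m x - G x / Z|)
      (g := fun x => |m x - G x * Real.exp (-H)| + |Real.exp (-H) * Z - 1| / Z * G x)
      (by fun_prop) (by fun_prop) fun x _ => by
        have h1 : |Real.exp (-H) * Z - 1| / Z * G x = |G x * Real.exp (-H) - G x / Z| := by
          rw [show G x * Real.exp (-H) - G x / Z = (Real.exp (-H) * Z - 1) / Z * G x by field_simp,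
            abs_mul, abs_div, abs_of_pos hZpos, abs_of_pos (hGpos x)]
        rw [h1]
        exact abs_sub_le _ _ _
    rw [intervalIntegral.integral_add (Continuous.intervalIntegrable (by fun_prop) _ _)
      (Continuous.intervalIntegrable (by fun_prop) _ _), intervalIntegral.integral_const_mul,
      ← hZ, div_mul_cancel₀ _ hZpos.ne'] at h
    linarith
  have hBk : 0 ≤ 2 * B / k * ε := by
    rw [div_mul_eq_mul_div]; positivity
  refine ⟨by linarith, ?_, ?_, ?_⟩ <;> nlinarith

theorem Qfun_nonneg (V b u m : ℝ → ℝ) (H : ℝ) : 0 ≤ Qfun V b u m H := by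
  have h : ∀ f : ℝ → ℝ, 0 ≤ ∫ x in (0 : ℝ)..1, f x ^ 2 := fun f =>
    intervalIntegral.integral_nonneg zero_le_one fun _ _ => sq_nonneg _
  exact add_nonneg (add_nonneg (add_nonneg (h _) (sq_nonneg _)) (sq_nonneg _)) (h _)

/-- The explicit solution is a zero of the residual functional. -/
theorem Qfun_eq_zero {V b u m : ℝ → ℝ} {H : ℝ} (hV : Continuous V) (hb : Continuous b)
    (hu : ∀ x, deriv u x = -b x) (hu0 : (∫ x in (0 : ℝ)..1, u x) = 0)
    (hm : ∀ x, m x = Real.exp (V x - b x ^ 2 / 2)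
      / ∫ y in (0 : ℝ)..1, Real.exp (V y - b y ^ 2 / 2))
    (hH : H = Real.log (∫ y in (0 : ℝ)..1, Real.exp (V y - b y ^ 2 / 2))) :
    Qfun V b u m H = 0 := by
  have hZ : 0 < ∫ y in (0 : ℝ)..1, Real.exp (V y - b y ^ 2 / 2) :=
    intervalIntegral.intervalIntegral_pos_of_pos
      (Continuous.intervalIntegrable (by fun_prop) _ _) (fun _ => Real.exp_pos _) zero_lt_one
  have h1 : ∀ x, Real.exp (V x + deriv u x ^ 2 / 2 + b x * deriv u x - H) - m x = 0 := fun x => by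
    rw [Real.exp_sub, hH, Real.exp_log hZ, hm, hu, sub_eq_zero]
    congr 2
    ring
  have h2 : (∫ x in (0 : ℝ)..1, m x) = 1 := by
    rw [funext hm, intervalIntegral.integral_div, div_self hZ.ne']
  have h3 : ∀ x, deriv (deriv u) x + deriv b x = 0 := fun x => by
    rw [funext hu, deriv.fun_neg]
    ring
  simp only [Qfun, h1, h2, h3, hu0]
  simp only [hu, neg_add_cancel]
  simp

/-- Theorem 2.6: convergence of minimizers of the Fourier features method to the
explicit solution of the one-dimensional stationary MFG, in `H¹` for `u`, in `L¹`
for `m`, and in `ℝ` for `H̄`. -/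
theorem stmt_8 (V b : ℝ → ℝ)
    (hV : ContDiff ℝ (⊤ : ℕ∞) V) (hVp : ∀ x, V (x + 1) = V x)
    (hb : ContDiff ℝ (⊤ : ℕ∞) b) (hbp : ∀ x, b (x + 1) = b x)
    (hbint : (∫ y in (0:ℝ)..1, b y) = 0)
    (ustar mstar : ℝ → ℝ) (Hstar : ℝ)
    (hus : ∀ x, ustar x
      = (∫ t in (0:ℝ)..1, ∫ y in (0:ℝ)..t, b y) - ∫ y in (0:ℝ)..x, b y)
    (hms : ∀ x, mstar x = Real.exp (V x - (b x) ^ 2 / 2)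
      / ∫ y in (0:ℝ)..1, Real.exp (V y - (b y) ^ 2 / 2))
    (hHs : Hstar = Real.log (∫ y in (0:ℝ)..1, Real.exp (V y - (b y) ^ 2 / 2))) :
    ∃ (Ns : ℕ → ℕ) (γs : ℕ → ℝ), (∀ i, 0 < γs i) ∧
      ∀ (us ms : ℕ → ℝ → ℝ) (Hs : ℕ → ℝ),
        (∀ i, inG (Ns i) (us i) ∧ inG (Ns i) (ms i) ∧
          ∀ (u' m' : ℝ → ℝ) (H' : ℝ), inG (Ns i) u' → inG (Ns i) m' →
            Jfun V b (γs i) (us i) (ms i) (Hs i) ≤ Jfun V b (γs i) u' m' H') →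
        Filter.Tendsto (fun i => ∫ x in (0:ℝ)..1, (us i x - ustar x) ^ 2)
          Filter.atTop (nhds 0) ∧
        Filter.Tendsto (fun i => ∫ x in (0:ℝ)..1, (deriv (us i) x - deriv ustar x) ^ 2)
          Filter.atTop (nhds 0) ∧
        Filter.Tendsto (fun i => ∫ x in (0:ℝ)..1, |ms i x - mstar x|)
          Filter.atTop (nhds 0) ∧
        Filter.Tendsto Hs Filter.atTop (nhds Hstar) := by
  have hVc := hV.continuous
  have hbc := hb.continuous
  have hZ : 0 < ∫ y in (0:ℝ)..1, Real.exp (V y - (b y) ^ 2 / 2) :=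
    intervalIntegral.intervalIntegral_pos_of_pos
      (Continuous.intervalIntegrable (by fun_prop) _ _) (fun _ => Real.exp_pos _) zero_lt_one
  have hud : ∀ x, HasDerivAt ustar (-b x) x := fun x => by
    rw [funext hus]
    exact (intervalIntegral.integral_hasDerivAt_right (hbc.intervalIntegrable _ _)
      (hbc.stronglyMeasurableAtFilter _ _) hbc.continuousAt).const_sub _
  have hud' : ∀ x, deriv ustar x = -b x := fun x => (hud x).deriv
  have husm : ContDiff ℝ (⊤ : ℕ∞) ustar := contDiff_infty_iff_deriv.mpr
    ⟨fun x => (hud x).differentiableAt, by rw [funext hud']; exact hb.neg⟩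
  have hup : Function.Periodic ustar 1 := fun x => by
    have h := Function.Periodic.intervalIntegral_add_eq (f := b) hbp x 0
    rw [zero_add, hbint] at h
    rw [hus, hus, ← intervalIntegral.integral_add_adjacent_intervals
      (hbc.intervalIntegrable 0 x) (hbc.intervalIntegrable x (x + 1)), h, add_zero]
  have hu0 : (∫ x in (0:ℝ)..1, ustar x) = 0 := by
    have hc : Continuous fun t => ∫ y in (0:ℝ)..t, b y :=
      intervalIntegral.continuous_primitive (fun _ _ => hbc.intervalIntegrable _ _) 0
    rw [funext hus, intervalIntegral.integral_sub (by simp) (hc.intervalIntegrable _ _)]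
    simp
  have hmsm : ContDiff ℝ (⊤ : ℕ∞) mstar := by
    rw [funext hms]
    exact ((hV.sub ((hb.pow 2).div_const 2)).exp).div_const _
  have hmp : Function.Periodic mstar 1 := fun x => by rw [hms, hms, hVp, hbp]
  have hQ0 := Qfun_eq_zero hVc hbc hud' hu0 hms hHs
  have hnn : ∀ f : ℝ → ℝ, 0 ≤ ∫ x in (0:ℝ)..1, f x ^ 2 := fun f =>
    intervalIntegral.integral_nonneg zero_le_one fun _ _ => sq_nonneg _
  set K := (∫ x in (0:ℝ)..1, ustar x ^ 2) + 1 + ((∫ x in (0:ℝ)..1, mstar x ^ 2) + 1)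
    + Hstar ^ 2 + 1 with hK
  have hKpos : 0 < K := by
    have := hnn ustar
    have := hnn mstar
    positivity
  let γ : ℕ → ℝ := fun i => K * ((i : ℝ) + 1) ^ 2
  have hγ : ∀ i, 0 < γ i := fun i => by positivity
  choose N φ ψ hφ hψ hφb hψb hQb using fun i => exists_inG_Qfun_lt Hstar hVc hb husm hmsm hup hmp
    (one_div_pos.mpr (hγ i))
  obtain ⟨C, hC⟩ := exists_stability_constant hVc hb hbint K
  refine ⟨N, γ, hγ, fun us ms Hs h => ?_⟩
  have hJ : ∀ i, Jfun V b (γ i) (us i) (ms i) (Hs i) ≤ K := fun i => by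
    refine ((h i).2.2 _ _ Hstar (hφ i) (hψ i)).trans ?_
    have h1 : γ i * Qfun V b (φ i) (ψ i) Hstar ≤ 1 := by
      have h2 := hQb i
      rw [hQ0, zero_add, lt_div_iff₀' (hγ i)] at h2
      exact h2.le
    unfold Jfun
    linarith [hφb i, hψb i]
  have hb1 : ∀ i, (∫ x in (0:ℝ)..1, us i x) ^ 2 ≤ (1 / ((i : ℝ) + 1)) ^ 2 ∧
      (∫ x in (0:ℝ)..1, (deriv (us i) x + b x) ^ 2) ≤ C * (1 / ((i : ℝ) + 1)) ∧
      (∫ x in (0:ℝ)..1, |ms i x - mstar x|) ≤ C * (1 / ((i : ℝ) + 1)) ∧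
      |Real.exp (-Hs i) * (∫ y in (0:ℝ)..1, Real.exp (V y - (b y) ^ 2 / 2)) - 1|
        ≤ C * (1 / ((i : ℝ) + 1)) := fun i => by
    have h1 := hJ i
    unfold Jfun at h1
    have h2 := hnn (us i)
    have h3 := hnn (ms i)
    have h4 := mul_nonneg (hγ i).le (Qfun_nonneg V b (us i) (ms i) (Hs i))
    have h5 := sq_nonneg (Hs i)
    have h6 : Qfun V b (us i) (ms i) (Hs i) ≤ (1 / ((i : ℝ) + 1)) ^ 2 := by
      rw [one_div_pow, le_div_iff₀ (by positivity)]
      have h7 : K * (Qfun V b (us i) (ms i) (Hs i) * ((i : ℝ) + 1) ^ 2) ≤ K * 1 := by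
        calc _ = γ i * Qfun V b (us i) (ms i) (Hs i) := by simp only [γ]; ring
          _ ≤ K * 1 := by linarith
      exact le_of_mul_le_mul_left h7 hKpos
    simp only [hms]
    exact hC _ _ _ _ (by positivity) (by
      rw [div_le_one (by positivity)]; linarith [i.cast_nonneg (α := ℝ)])
      (h i).1.contDiff (h i).2.1.contDiff (h i).1.one_eq_zero (by linarith) (by linarith) h6
  have hε := tendsto_one_div_add_atTop_nhds_zero_nat (𝕜 := ℝ)
  have hCε : Filter.Tendsto (fun i : ℕ => C * (1 / ((i : ℝ) + 1))) Filter.atTop (nhds 0) := by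
    simpa using hε.const_mul C
  refine ⟨?_, ?_, ?_, ?_⟩
  · have hlim : Filter.Tendsto (fun i : ℕ => 2 * (C * (1 / ((i : ℝ) + 1)))
        + 2 * (1 / ((i : ℝ) + 1)) ^ 2) Filter.atTop (nhds 0) := by
      simpa using (hCε.const_mul 2).add ((hε.pow 2).const_mul 2)
    refine squeeze_zero (fun i => hnn _) (fun i => ?_) hlim
    have hus' := (h i).1.contDiff
    have hP := integral_sq_le_of_hasDerivAt (f := fun x => us i x - ustar x)
      (r := fun x => deriv (us i) x + b x)
      ((contDiff_infty_iff_deriv.mp hus').2.continuous.add hbc) fun x =>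
        (((contDiff_infty_iff_deriv.mp hus').1 x).hasDerivAt.sub (hud x)).congr_deriv (by ring)
    rw [intervalIntegral.integral_sub (hus'.continuous.intervalIntegrable _ _)
      (husm.continuous.intervalIntegrable _ _), hu0, sub_zero] at hP
    linarith [(hb1 i).1, (hb1 i).2.1]
  · refine squeeze_zero (fun i => hnn _) (fun i => ?_) hCε
    simpa only [hud', sub_neg_eq_add] using (hb1 i).2.1
  · exact squeeze_zero (fun i => intervalIntegral.integral_nonneg zero_le_one
      fun _ _ => abs_nonneg _) (fun i => (hb1 i).2.2.1) hCε
  · set Z := ∫ y in (0:ℝ)..1, Real.exp (V y - (b y) ^ 2 / 2)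
    have h1 : Filter.Tendsto (fun i => Real.exp (-Hs i) * Z) Filter.atTop (nhds 1) := by
      rw [tendsto_iff_norm_sub_tendsto_zero]
      exact squeeze_zero (fun _ => norm_nonneg _) (fun i => (hb1 i).2.2.2) hCε
    have h2 := (h1.log one_ne_zero).const_sub (Real.log Z)
    rw [Real.log_one, sub_zero, ← hHs] at h2
    refine h2.congr fun i => ?_
    rw [Real.log_mul (Real.exp_pos _).ne' hZ.ne', Real.log_exp, hHs]
    ring
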